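/- Fix γ>0 and p>0, and for a>0 define h_a(t):=a·t^{−4}+γ·t^p·(ln(1/t))^p for t∈(0,1/(e+1)). Then for all sufficiently small a>0, h_a attains a unique minimum on (0,1/(e+1)) at a point t₀=t₀(a), and as a↘0: t₀ = (1+o(1))·(4/(pγ))^{1/(p+4)}·(p+4)^{p/(p+4)}·a^{1/(p+4)}·(ln(1/a))^{−p/(p+4)} and h_a(t₀) = (1+o(1))·γ^{4/(p+4)}·(1/(p+4))^{4p/(p+4)}·[(p/4)^{4/(p+4)}+(4/p)^{p/(p+4)}]·a^{p/(p+4)}·(ln(1/a))^{4p/(p+4)}. -/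

import Mathlib

open Filter Topology Set

noncomputable section

/-- The auxiliary function `h_a(t) = a t^{-4} + γ t^p (ln(1/t))^p` of Remark 3.1. -/
def hAux (γ p a t : ℝ) : ℝ :=
  a * t ^ (-(4 : ℝ)) + γ * t ^ p * (Real.log (1 / t)) ^ p

/-- The logarithm, up to an additive constant, of the parameter `a` for which `exp (-x)` is the
critical point of `h_a`. -/
def critLog (p x : ℝ) : ℝ :=
  -(p + 4) * x + (p - 1) * Real.log x + Real.log (x - 1)

/-- The parameter `a` for which `exp (-x)` is the critical point of `h_a`. -/
def critParam (γ p x : ℝ) : ℝ :=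
  γ * p / 4 * Real.exp (critLog p x)

lemma hasDerivAt_critLog (p : ℝ) {x : ℝ} (hx : 1 < x) :
    HasDerivAt (critLog p) (-(p + 4) + (p - 1) / x + 1 / (x - 1)) x := by
  have h1 := (hasDerivAt_id x).const_mul (-(p + 4))
  have h2 := (Real.hasDerivAt_log (by linarith : x ≠ 0)).const_mul (p - 1)
  have h3 := ((hasDerivAt_id x).sub_const 1).log (by simp only [id]; linarith)
  refine ((h1.add h2).add h3).congr_deriv ?_
  simp only [id]
  ring

lemma strictAntiOn_critLog {p : ℝ} (hp : 0 < p) :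
    StrictAntiOn (critLog p) (Ici (5 / 4)) := by
  apply strictAntiOn_of_deriv_neg (convex_Ici _)
  · intro x hx
    have hx : (5 / 4 : ℝ) ≤ x := hx
    exact (hasDerivAt_critLog p (by linarith)).continuousAt.continuousWithinAt
  · intro x hx
    rw [interior_Ici] at hx
    have hx : (5 / 4 : ℝ) < x := hx
    rw [(hasDerivAt_critLog p (by linarith)).deriv]
    have hx1 : 0 < x - 1 := by linarith
    have hx0 : 0 < x := by linarith
    have : -(p + 4) + (p - 1) / x + 1 / (x - 1)
        = -(p * (x - 1) / x) - (4 * x * (x - 1) - 1) / (x * (x - 1)) := by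
      field_simp
      ring
    rw [this]
    have h1 : 0 < p * (x - 1) / x := by positivity
    have h2 : 0 < (4 * x * (x - 1) - 1) / (x * (x - 1)) := by
      apply div_pos _ (by positivity)
      nlinarith
    linarith

lemma critLog_le {p : ℝ} (hp : 0 < p) {x : ℝ} (hx : 1 < x) : critLog p x ≤ -4 * x := by
  have h1 : Real.log (x - 1) ≤ Real.log x := Real.log_le_log (by linarith) (by linarith)
  have h2 := Real.log_le_sub_one_of_pos (by linarith : 0 < x)
  unfold critLog
  nlinarith

lemma critParam_pos {γ p : ℝ} (hγ : 0 < γ) (hp : 0 < p) (x : ℝ) : 0 < critParam γ p x := by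
  unfold critParam
  positivity

lemma log_critParam {γ p : ℝ} (hγ : 0 < γ) (hp : 0 < p) (x : ℝ) :
    Real.log (critParam γ p x) = Real.log (γ * p / 4) + critLog p x := by
  unfold critParam
  rw [Real.log_mul (by positivity) (by positivity), Real.log_exp]

lemma strictAntiOn_critParam {γ p : ℝ} (hγ : 0 < γ) (hp : 0 < p) :
    StrictAntiOn (critParam γ p) (Ici (5 / 4)) := fun _ hx _ hy hxy =>
  mul_lt_mul_of_pos_left (Real.exp_lt_exp.2 (strictAntiOn_critLog hp hx hy hxy)) (by positivity)

lemma continuousOn_critParam (γ p : ℝ) : ContinuousOn (critParam γ p) (Ici (5 / 4)) := by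
  intro x hx
  have hx : (5 / 4 : ℝ) ≤ x := hx
  have h := (hasDerivAt_critLog p (by linarith : 1 < x)).continuousAt
  exact (continuousAt_const.mul h.rexp).continuousWithinAt

lemma tendsto_critParam_atTop (γ : ℝ) {p : ℝ} (hp : 0 < p) :
    Tendsto (critParam γ p) atTop (𝓝 0) := by
  have h : Tendsto (critLog p) atTop atBot := by
    refine tendsto_atBot_mono' atTop ?_
      (tendsto_id.const_mul_atTop_of_neg (by norm_num : (-4 : ℝ) < 0))
    filter_upwards [eventually_gt_atTop 1] with x hx using critLog_le hp hx
  have h' := (Real.tendsto_exp_atBot.comp h).const_mul (γ * p / 4)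
  rwa [mul_zero] at h'

lemma exists_critParam_eq {γ p : ℝ} (hp : 0 < p) {x₀ a : ℝ} (hx₀ : 5 / 4 ≤ x₀) (ha : 0 < a)
    (ha' : a < critParam γ p x₀) : ∃ x, x₀ < x ∧ critParam γ p x = a := by
  obtain ⟨y, hy, hxy⟩ := (((tendsto_critParam_atTop γ hp).eventually_lt_const ha).and
    (eventually_gt_atTop x₀)).exists
  have hc : ContinuousOn (critParam γ p) (Icc x₀ y) :=
    (continuousOn_critParam γ p).mono fun z hz => hx₀.trans hz.1
  obtain ⟨x, hx, hxa⟩ := intermediate_value_Ioo' hxy.le hc ⟨hy, ha'⟩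
  exact ⟨x, hx.1, hxa⟩

lemma hAux_exp_neg (γ p a x : ℝ) :
    hAux γ p a (Real.exp (-x)) =
      a * Real.exp (4 * x) + γ * Real.exp (-p * x) * x ^ p := by
  unfold hAux
  rw [← Real.exp_mul, ← Real.exp_mul, one_div, ← Real.exp_neg, Real.log_exp, neg_neg]
  ring_nf

lemma critParam_eq {γ p x : ℝ} (hx : 1 < x) :
    critParam γ p x = γ * p / 4 * (Real.exp (-(p + 4) * x) * x ^ (p - 1) * (x - 1)) := by
  unfold critParam critLog
  rw [Real.exp_add, Real.exp_add, Real.exp_log (by linarith : 0 < x - 1),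
    Real.rpow_def_of_pos (by linarith : 0 < x), mul_comm (Real.log x)]

lemma hasDerivAt_hAux_exp_neg (γ p a : ℝ) {x : ℝ} (hx : 1 < x) :
    HasDerivAt (fun y => hAux γ p a (Real.exp (-y)))
      (4 * Real.exp (4 * x) * (a - critParam γ p x)) x := by
  have hx0 : x ≠ 0 := by linarith
  have h1 := (((hasDerivAt_id x).const_mul 4).exp).const_mul a
  have h2 := (((hasDerivAt_id x).const_mul (-p)).exp).const_mul γ
  have h3 := Real.hasDerivAt_rpow_const (p := p) (Or.inl hx0)
  have h := h1.add (h2.mul h3)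
  simp only [hAux_exp_neg]
  refine h.congr_deriv ?_
  simp only [id]
  have e1 : Real.exp (-(p + 4) * x) = Real.exp (-p * x) * (Real.exp (4 * x))⁻¹ := by
    rw [← Real.exp_neg, ← Real.exp_add]
    ring_nf
  have e2 : x ^ p = x ^ (p - 1) * x := by
    rw [Real.rpow_sub_one hx0]
    field_simp
  rw [critParam_eq hx, e1, e2]
  field_simp
  ring

lemma hAux_exp_neg_lt {γ p : ℝ} (hγ : 0 < γ) (hp : 0 < p) {x y : ℝ} (hx : 5 / 4 ≤ x)
    (hy : 5 / 4 ≤ y) (hxy : y ≠ x) :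
    hAux γ p (critParam γ p x) (Real.exp (-x)) < hAux γ p (critParam γ p x) (Real.exp (-y)) := by
  have hanti := strictAntiOn_critParam hγ hp
  rcases lt_or_gt_of_ne hxy with h | h
  · have : StrictAntiOn (fun y => hAux γ p (critParam γ p x) (Real.exp (-y))) (Icc (5 / 4) x) := by
      apply strictAntiOn_of_deriv_neg (convex_Icc _ _)
      · intro z hz
        exact (hasDerivAt_hAux_exp_neg γ p _
          (by linarith [hz.1] : 1 < z)).continuousAt.continuousWithinAt
      · intro z hz
        rw [interior_Icc] at hz
        rw [(hasDerivAt_hAux_exp_neg γ p _ (by linarith [hz.1] : 1 < z)).deriv]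
        exact mul_neg_of_pos_of_neg (by positivity) (sub_neg.2 (hanti hz.1.le hx hz.2))
    exact this ⟨hy, h.le⟩ ⟨hx, le_rfl⟩ h
  · have : StrictMonoOn (fun y => hAux γ p (critParam γ p x) (Real.exp (-y))) (Ici x) := by
      apply strictMonoOn_of_deriv_pos (convex_Ici _)
      · intro z hz
        have hz : x ≤ z := hz
        exact (hasDerivAt_hAux_exp_neg γ p _
          (by linarith : 1 < z)).continuousAt.continuousWithinAt
      · intro z hz
        rw [interior_Ici] at hz
        have hz : x < z := hz
        rw [(hasDerivAt_hAux_exp_neg γ p _ (by linarith : 1 < z)).deriv]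
        exact mul_pos (by positivity) (sub_pos.2 (hanti hx (hx.trans hz.le) hz))
    exact this self_mem_Ici h.le h

lemma five_div_four_le_log : (5 / 4 : ℝ) ≤ Real.log (Real.exp 1 + 1) := by
  rw [Real.le_log_iff_exp_le (by positivity)]
  have h : Real.exp (1 / 4) ≤ 4 / 3 := by
    have := Real.exp_bound_div_one_sub_of_interval (by norm_num : (0 : ℝ) ≤ 1 / 4) (by norm_num)
    norm_num at this ⊢
    linarith
  have he : Real.exp (5 / 4) = Real.exp 1 * Real.exp (1 / 4) := by
    rw [← Real.exp_add]
    norm_num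
  rw [he]
  nlinarith [Real.exp_one_lt_d9, Real.exp_pos 1]

lemma tendsto_sub_one_div : Tendsto (fun x : ℝ => (x - 1) / x) atTop (𝓝 1) := by
  have h : Tendsto (fun x : ℝ => 1 - x⁻¹) atTop (𝓝 (1 - 0)) :=
    tendsto_const_nhds.sub tendsto_inv_atTop_zero
  rw [sub_zero] at h
  refine h.congr' ?_
  filter_upwards [eventually_gt_atTop 0] with x hx
  field_simp

lemma tendsto_neg_log_critParam_div {γ p : ℝ} (hγ : 0 < γ) (hp : 0 < p) :
    Tendsto (fun x => -Real.log (critParam γ p x) / ((p + 4) * x)) atTop (𝓝 1) := by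
  have hlog : Tendsto (fun x : ℝ => Real.log x / x) atTop (𝓝 0) :=
    Real.isLittleO_log_id_atTop.tendsto_div_nhds_zero
  have hu := tendsto_sub_one_div.log one_ne_zero
  have h := ((hlog.const_mul (p / (p + 4))).const_sub 1).sub
    ((hu.const_add (Real.log (γ * p / 4))).mul
      (tendsto_inv_atTop_zero.const_mul (1 / (p + 4))))
  simp only [mul_zero, sub_zero] at h
  refine h.congr' ?_
  filter_upwards [eventually_gt_atTop 1] with x hx
  have hx0 : x ≠ 0 := by linarith
  rw [log_critParam hγ hp, critLog, Real.log_div (x := x - 1) (by linarith) hx0]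
  field_simp
  ring

lemma log_critParam_eq {γ p x : ℝ} (hγ : 0 < γ) (hp : 0 < p) (hx : 1 < x) :
    Real.log (critParam γ p x) = Real.log γ + Real.log p - Real.log 4 - (p + 4) * x
      + p * Real.log x + Real.log ((x - 1) / x) := by
  rw [log_critParam hγ hp, critLog, Real.log_div (x := x - 1) (by linarith) (by linarith),
    Real.log_div (by positivity) (by norm_num), Real.log_mul hγ.ne' hp.ne']
  ring

lemma argmin_ratio_eq {γ p x : ℝ} (hγ : 0 < γ) (hp : 0 < p) (hx : 1 < x)
    (hΛ : critParam γ p x < 1) :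
    Real.exp (-x) /
        ((4 / (p * γ)) ^ ((1 : ℝ) / (p + 4)) * (p + 4) ^ (p / (p + 4)) *
          critParam γ p x ^ ((1 : ℝ) / (p + 4)) *
            (Real.log (1 / critParam γ p x)) ^ (-(p / (p + 4)))) =
      (-Real.log (critParam γ p x) / ((p + 4) * x)) ^ (p / (p + 4)) *
        ((x - 1) / x) ^ (-(1 / (p + 4))) := by
  have ha := critParam_pos hγ hp x
  have hneg := Real.log_neg ha hΛ
  have hL := log_critParam_eq hγ hp hx
  have hu : 0 < (x - 1) / x := div_pos (by linarith) (by linarith)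
  rw [one_div (critParam γ p x), Real.log_inv]
  generalize critParam γ p x = a at *
  generalize (x - 1) / x = u at *
  have hΛ0 : 0 < -Real.log a := by linarith
  generalize hM : -Real.log a = M at *
  have hx0 : 0 < x := by linarith
  have hp4 : 0 < p + 4 := by linarith
  apply Real.log_injOn_pos (by simp only [mem_Ioi]; positivity) (by simp only [mem_Ioi]; positivity)
  rw [Real.log_div (by positivity) (by positivity), Real.log_mul (by positivity) (by positivity),
    Real.log_mul (by positivity) (by positivity), Real.log_mul (by positivity) (by positivity),
    Real.log_mul (by positivity) (by positivity), Real.log_exp, Real.log_rpow (by positivity),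
    Real.log_rpow hp4, Real.log_rpow ha, Real.log_rpow hΛ0, Real.log_rpow (by positivity),
    Real.log_rpow hu, Real.log_div (by positivity) (by positivity),
    Real.log_div (by positivity) (by positivity), Real.log_mul hp.ne' hγ.ne',
    Real.log_mul hp4.ne' hx0.ne', hL]
  field_simp
  ring

lemma min_const_eq {p : ℝ} (hp : 0 < p) :
    (p / 4) ^ ((4 : ℝ) / (p + 4)) + (4 / p) ^ (p / (p + 4)) =
      (p / 4 + 1) * (4 / p) ^ (p / (p + 4)) := by
  have h : (p / 4) ^ ((4 : ℝ) / (p + 4)) = p / 4 * (4 / p) ^ (p / (p + 4)) := by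
    have hp4 : 0 < p + 4 := by linarith
    apply Real.log_injOn_pos (by simp only [mem_Ioi]; positivity)
      (by simp only [mem_Ioi]; positivity)
    rw [Real.log_mul (by positivity) (by positivity), Real.log_rpow (by positivity),
      Real.log_rpow (by positivity), Real.log_div (by positivity) (by positivity),
      Real.log_div (by positivity) (by positivity)]
    field_simp
    ring
  rw [h]
  ring

lemma hAux_critParam {γ p x : ℝ} (hx : 1 < x) :
    hAux γ p (critParam γ p x) (Real.exp (-x)) =
      γ * Real.exp (-p * x) * x ^ p * (p / 4 * ((x - 1) / x) + 1) := by
  have hx0 : x ≠ 0 := by linarith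
  have e1 : Real.exp (-(p + 4) * x) = Real.exp (-p * x) * (Real.exp (4 * x))⁻¹ := by
    rw [← Real.exp_neg, ← Real.exp_add]
    ring_nf
  rw [hAux_exp_neg, critParam_eq hx, e1, Real.rpow_sub_one hx0]
  field_simp

lemma min_ratio_eq {γ p x : ℝ} (hγ : 0 < γ) (hp : 0 < p) (hx : 1 < x)
    (hΛ : critParam γ p x < 1) :
    hAux γ p (critParam γ p x) (Real.exp (-x)) /
        (γ ^ ((4 : ℝ) / (p + 4)) * (1 / (p + 4)) ^ (4 * p / (p + 4)) *
          ((p / 4) ^ ((4 : ℝ) / (p + 4)) + (4 / p) ^ (p / (p + 4))) *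
          critParam γ p x ^ (p / (p + 4)) *
            (Real.log (1 / critParam γ p x)) ^ (4 * p / (p + 4))) =
      (p / 4 * ((x - 1) / x) + 1) / (p / 4 + 1) *
        ((-Real.log (critParam γ p x) / ((p + 4) * x)) ^ (-(4 * p / (p + 4))) *
          ((x - 1) / x) ^ (-(p / (p + 4)))) := by
  rw [min_const_eq hp, hAux_critParam hx]
  have ha := critParam_pos hγ hp x
  have hneg := Real.log_neg ha hΛ
  have hL := log_critParam_eq hγ hp hx
  have hu : 0 < (x - 1) / x := div_pos (by linarith) (by linarith)
  rw [one_div (critParam γ p x), Real.log_inv]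
  generalize critParam γ p x = a at *
  generalize (x - 1) / x = u at *
  have hΛ0 : 0 < -Real.log a := by linarith
  generalize hM : -Real.log a = M at *
  have hx0 : 0 < x := by linarith
  have hp4 : 0 < p + 4 := by linarith
  have hs : 0 < p / 4 * u + 1 := by positivity
  have hr : 0 < p / 4 + 1 := by positivity
  generalize p / 4 * u + 1 = s at *
  generalize p / 4 + 1 = r at *
  apply Real.log_injOn_pos (by simp only [mem_Ioi]; positivity) (by simp only [mem_Ioi]; positivity)
  rw [Real.log_div (by positivity) (by positivity)]
  repeat rw [Real.log_mul (by positivity) (by positivity)]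
  rw [Real.log_div hs.ne' hr.ne', Real.log_exp, Real.log_rpow hx0, Real.log_rpow hγ,
    Real.log_rpow (by positivity), Real.log_rpow (by positivity), Real.log_rpow ha,
    Real.log_rpow hΛ0, Real.log_rpow (by positivity),
    Real.log_rpow hu, Real.log_div (by positivity) (by positivity),
    Real.log_div (by positivity) (by positivity), Real.log_div (by positivity) (by positivity),
    Real.log_mul hp4.ne' hx0.ne', hL, Real.log_one]
  field_simp
  ring

/-- Remark 3.1: for small `a > 0`, `h_a` has a unique minimum point
`t₀(a)` on `(0, 1/(e+1))`, with the stated asymptotics of `t₀(a)` and `h_a(t₀(a))`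
as `a ↘ 0`. -/
theorem stmt14 (γ p : ℝ) (hγ : 0 < γ) (hp : 0 < p) :
    ∃ t₀ : ℝ → ℝ,
      (∀ᶠ a in 𝓝[>] (0 : ℝ),
        t₀ a ∈ Ioo (0 : ℝ) (1 / (Real.exp 1 + 1)) ∧
        (∀ t ∈ Ioo (0 : ℝ) (1 / (Real.exp 1 + 1)), hAux γ p a (t₀ a) ≤ hAux γ p a t) ∧
        (∀ t ∈ Ioo (0 : ℝ) (1 / (Real.exp 1 + 1)),
          hAux γ p a t = hAux γ p a (t₀ a) → t = t₀ a)) ∧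
      Tendsto (fun a => t₀ a /
          ((4 / (p * γ)) ^ ((1 : ℝ) / (p + 4)) * (p + 4) ^ (p / (p + 4)) *
            a ^ ((1 : ℝ) / (p + 4)) * (Real.log (1 / a)) ^ (-(p / (p + 4)))))
        (𝓝[>] (0 : ℝ)) (𝓝 1) ∧
      Tendsto (fun a => hAux γ p a (t₀ a) /
          (γ ^ ((4 : ℝ) / (p + 4)) * (1 / (p + 4)) ^ (4 * p / (p + 4)) *
            ((p / 4) ^ ((4 : ℝ) / (p + 4)) + (4 / p) ^ (p / (p + 4))) *
            a ^ (p / (p + 4)) * (Real.log (1 / a)) ^ (4 * p / (p + 4))))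
        (𝓝[>] (0 : ℝ)) (𝓝 1) := by
  have hx₀ := five_div_four_le_log
  set x₀ := Real.log (Real.exp 1 + 1) with hx₀_def
  have hend : 1 / (Real.exp 1 + 1) = Real.exp (-x₀) := by
    rw [Real.exp_neg, Real.exp_log (by positivity), one_div]
  have hex : ∀ a, ∃ x, 0 < a → a < critParam γ p x₀ → x₀ < x ∧ critParam γ p x = a := by
    intro a
    by_cases h : 0 < a ∧ a < critParam γ p x₀
    · obtain ⟨x, hx⟩ := exists_critParam_eq hp hx₀ h.1 h.2
      exact ⟨x, fun _ _ => hx⟩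
    · exact ⟨0, fun h1 h2 => absurd ⟨h1, h2⟩ h⟩
  choose X hX using hex
  have hX' : ∀ᶠ a in 𝓝[>] (0 : ℝ), x₀ < X a ∧ critParam γ p (X a) = a := by
    filter_upwards [Ioo_mem_nhdsGT (critParam_pos hγ hp x₀)] with a ha using hX a ha.1 ha.2
  have hXtop : Tendsto X (𝓝[>] 0) atTop := by
    refine tendsto_atTop.2 fun M => ?_
    filter_upwards [hX', Ioo_mem_nhdsGT (critParam_pos hγ hp (max M x₀))] with a ha hM
    by_contra! hlt
    have hle : X a ≤ max M x₀ := hlt.le.trans (le_max_left _ _)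
    have := (strictAntiOn_critParam hγ hp).antitoneOn (hx₀.trans ha.1.le)
      (hx₀.trans (le_max_right M x₀)) hle
    rw [ha.2] at this
    exact absurd hM.2 (not_lt.2 this)
  have hρ := (tendsto_neg_log_critParam_div hγ hp).comp hXtop
  have hu := tendsto_sub_one_div.comp hXtop
  have hsmall : ∀ᶠ a in 𝓝[>] (0 : ℝ), a < 1 :=
    mem_of_superset (Ioo_mem_nhdsGT one_pos) fun _ h => h.2
  refine ⟨fun a => Real.exp (-X a), ?_, ?_, ?_⟩
  · filter_upwards [hX'] with a ⟨hxa, hAa⟩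
    have hmin : ∀ t ∈ Ioo (0 : ℝ) (1 / (Real.exp 1 + 1)), t ≠ Real.exp (-X a) →
        hAux γ p a (Real.exp (-X a)) < hAux γ p a t := by
      intro t ht hne
      obtain ⟨y, rfl⟩ : ∃ y, t = Real.exp (-y) :=
        ⟨-Real.log t, by rw [neg_neg, Real.exp_log ht.1]⟩
      have hy : x₀ < y := by
        have := ht.2
        rw [hend, Real.exp_lt_exp] at this
        linarith
      have := hAux_exp_neg_lt hγ hp (hx₀.trans hxa.le) (hx₀.trans hy.le)
        (fun h => hne (by rw [h]))
      rwa [hAa] at this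
    refine ⟨⟨Real.exp_pos _, ?_⟩, fun t ht => ?_, fun t ht h => ?_⟩
    · rw [hend, Real.exp_lt_exp]
      linarith
    · by_cases h : t = Real.exp (-X a)
      · rw [h]
      · exact (hmin t ht h).le
    · by_contra hne
      exact (hmin t ht hne).ne' h
  · have h := (hρ.rpow_const (p := p / (p + 4)) (Or.inl one_ne_zero)).mul
      (hu.rpow_const (p := -(1 / (p + 4))) (Or.inl one_ne_zero))
    simp only [Real.one_rpow, mul_one] at h
    refine h.congr' ?_
    filter_upwards [hX', hsmall] with a ⟨hxa, hAa⟩ ha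
    have := argmin_ratio_eq hγ hp (by linarith : 1 < X a) (by rwa [hAa])
    simp only [Function.comp_apply]
    rw [← this, hAa]
  · have h := (((hu.const_mul (p / 4)).add_const 1).div_const (p / 4 + 1)).mul
      ((hρ.rpow_const (p := -(4 * p / (p + 4))) (Or.inl one_ne_zero)).mul
      (hu.rpow_const (p := -(p / (p + 4))) (Or.inl one_ne_zero)))
    simp only [Real.one_rpow, mul_one, div_self (by positivity : p / 4 + 1 ≠ 0)] at h
    refine h.congr' ?_
    filter_upwards [hX', hsmall] with a ⟨hxa, hAa⟩ ha
    have := min_ratio_eq hγ hp (by linarith : 1 < X a) (by rwa [hAa])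
    simp only [Function.comp_apply]
    rw [← this, hAa]
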